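/- For any permutation w, the difference [321;3412](w) − rep(w) is at least the number of values r for which w has an r-occurrence of some pattern in Φ, where Φ = {4321, 34512, 45123, 35412, 43512, 45132, 45213, 53412, 45312, 45231}. -/

import Mathlib

/-!
Common framework.  Permutations of `{1, …, m}` are modelled as `Equiv.Perm (Fin m)`
with 0-based positions and values.  The simple reflection `sr m i` (for
`0 ≤ i ≤ m - 2`, corresponding to the paper's `s_{i+1}`) swaps the values `i` and
`i + 1`.  Cut statistics `Mstat w k` / `mstat w k` (the paper's `M_{k+1}`/`m_{k+1}`)
are respectively the maximum of the first `k + 1` entries and the minimum of the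
remaining entries of the one-line notation of `w`.
-/

/-- The simple reflection swapping `i` and `i + 1` (0-based) in the symmetric group
on `Fin m`; the identity if out of range. -/
def sr (m i : ℕ) : Equiv.Perm (Fin m) :=
  if h : i + 1 < m then Equiv.swap ⟨i, Nat.lt_of_succ_lt h⟩ ⟨i + 1, h⟩ else 1

/-- `l` is a word in the simple reflections whose product is `w`. -/
def IsWord (m : ℕ) (l : List ℕ) (w : Equiv.Perm (Fin m)) : Prop :=
  (∀ i ∈ l, i + 1 < m) ∧ (l.map (sr m)).prod = w

/-- The Coxeter length `ℓ(w)`: the minimal length of a word expressing `w`. -/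
noncomputable def len {m : ℕ} (w : Equiv.Perm (Fin m)) : ℕ :=
  sInf {c | ∃ l : List ℕ, IsWord m l w ∧ l.length = c}

/-- `l` is a reduced decomposition of `w`. -/
def IsReducedWord {m : ℕ} (w : Equiv.Perm (Fin m)) (l : List ℕ) : Prop :=
  IsWord m l w ∧ l.length = len w

/-- The support of `w`: the letters appearing in some reduced decomposition. -/
noncomputable def supp {m : ℕ} (w : Equiv.Perm (Fin m)) : Set ℕ :=
  {i | ∃ l : List ℕ, IsReducedWord w l ∧ i ∈ l}

/-- `rep w = ℓ(w) - |supp w|`, the number of repeated letters. -/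
noncomputable def rep {m : ℕ} (w : Equiv.Perm (Fin m)) : ℕ :=
  len w - (supp w).ncard

/-- The value of `w` at the (0-based) position `i`, as a natural number. -/
def valAt {m : ℕ} (w : Equiv.Perm (Fin m)) (i : ℕ) : ℕ :=
  if h : i < m then (w ⟨i, h⟩ : ℕ) else 0

/-- The (0-based) position at which the value `v` occurs in `w`. -/
def posOf {m : ℕ} (w : Equiv.Perm (Fin m)) (v : ℕ) : ℕ :=
  if h : v < m then (w⁻¹ ⟨v, h⟩ : ℕ) else 0

/-- `Mstat w k`: the maximum of the first `k + 1` entries of `w`. -/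
noncomputable def Mstat {m : ℕ} (w : Equiv.Perm (Fin m)) (k : ℕ) : ℕ :=
  sSup {v | ∃ i : Fin m, (i : ℕ) ≤ k ∧ (w i : ℕ) = v}

/-- `mstat w k`: the minimum of the entries of `w` in positions `> k`. -/
noncomputable def mstat {m : ℕ} (w : Equiv.Perm (Fin m)) (k : ℕ) : ℕ :=
  sInf {v | ∃ i : Fin m, k < (i : ℕ) ∧ (w i : ℕ) = v}

/-- `wbar` is obtained from `w` by deleting the largest letter from the one-line
notation of `w` and sliding all subsequent letters one space to the left. -/
def IsDeletion {n : ℕ} (w : Equiv.Perm (Fin (n + 1))) (wbar : Equiv.Perm (Fin n)) : Prop :=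
  ∀ i : Fin n, (wbar i : ℕ) =
    if (i : ℕ) < posOf w n then valAt w (i : ℕ) else valAt w ((i : ℕ) + 1)

/-- `newrep w wbar`: the letters `k` with `s_k ∈ supp(wbar)` and `w⁻¹(top) ≤ k`. -/
noncomputable def newrep {n : ℕ} (w : Equiv.Perm (Fin (n + 1))) (wbar : Equiv.Perm (Fin n)) :
    Set ℕ :=
  {k | k ∈ supp wbar ∧ posOf w n ≤ k}

/-- An occurrence of the pattern `p` in `w`, recorded by its set `S` of values:
there are positions `f 0 < f 1 < ⋯` whose values are in the same relative order
as `p`, and `S` is the corresponding set of values. -/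
def IsOccSet {m c : ℕ} (p : Fin c → ℕ) (w : Equiv.Perm (Fin m)) (S : Finset ℕ) : Prop :=
  ∃ f : Fin c → Fin m, StrictMono f ∧ (∀ a b : Fin c, p a < p b ↔ w (f a) < w (f b)) ∧
    S = Finset.image (fun a => (w (f a) : ℕ)) Finset.univ

/-- An `N`-occurrence (here `N = n`, the largest 0-based value): an occurrence
whose largest letter is the largest value of `w`. -/
def IsTopOccSet {n c : ℕ} (p : Fin c → ℕ) (w : Equiv.Perm (Fin (n + 1))) (S : Finset ℕ) : Prop :=
  IsOccSet p w S ∧ n ∈ S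

/-- The number of occurrences of the pattern `p` in `w`. -/
noncomputable def occCount {m c : ℕ} (p : Fin c → ℕ) (w : Equiv.Perm (Fin m)) : ℕ :=
  Set.ncard {S : Finset ℕ | IsOccSet p w S}

/-- The number of `N`-occurrences of the pattern `p` in `w`. -/
noncomputable def topOccCount {n c : ℕ} (p : Fin c → ℕ) (w : Equiv.Perm (Fin (n + 1))) : ℕ :=
  Set.ncard {S : Finset ℕ | IsTopOccSet p w S}

def p321 : Fin 3 → ℕ := ![3, 2, 1]
def p3412 : Fin 4 → ℕ := ![3, 4, 1, 2]
def p4321 : Fin 4 → ℕ := ![4, 3, 2, 1]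
def p34512 : Fin 5 → ℕ := ![3, 4, 5, 1, 2]
def p45123 : Fin 5 → ℕ := ![4, 5, 1, 2, 3]
def p35412 : Fin 5 → ℕ := ![3, 5, 4, 1, 2]
def p43512 : Fin 5 → ℕ := ![4, 3, 5, 1, 2]
def p45132 : Fin 5 → ℕ := ![4, 5, 1, 3, 2]
def p45213 : Fin 5 → ℕ := ![4, 5, 2, 1, 3]
def p53412 : Fin 5 → ℕ := ![5, 3, 4, 1, 2]
def p45312 : Fin 5 → ℕ := ![4, 5, 3, 1, 2]
def p45231 : Fin 5 → ℕ := ![4, 5, 2, 3, 1]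

/-- The pattern `𝔭_k(w)` of Definition 4.4, recorded as its set of values:
(I) if `w⁻¹(top)` is left of `w⁻¹(M_k)`, the 321-occurrence `{top, M_k, m_k}`;
(II) else if `wbar(k) > m_k`, the 321-occurrence `{top, wbar(k), m_k}`;
(III) otherwise the 3412-occurrence `{M_k, top, wbar(k), m_k}`. -/
noncomputable def pocc {n : ℕ} (w : Equiv.Perm (Fin (n + 1))) (wbar : Equiv.Perm (Fin n))
    (k : ℕ) : Finset ℕ :=
  if posOf w n < posOf w (Mstat wbar k) then {n, Mstat wbar k, mstat wbar k}
  else if mstat wbar k < valAt wbar k then {n, valAt wbar k, mstat wbar k}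
  else {Mstat wbar k, n, valAt wbar k, mstat wbar k}

section PositionFunction

open Finset Classical

/-- Values smaller than `r` occurring after `r`, for the position function `π`. -/
noncomputable def smallerAfter (π : ℕ → ℕ) (r : ℕ) : Finset ℕ :=
  (range r).filter fun a => π r < π a

/-- The cuts `k` for which, among the values below `r`, some value `> k` occurs before some
value `≤ k`. -/
noncomputable def brokenCuts (π : ℕ → ℕ) (r : ℕ) : Finset ℕ :=
  (range r).filter fun k => ∃ a b, a ≤ k ∧ k < b ∧ b < r ∧ π b < π a

/-- Encoded `r`-occurrences of `321` and `3412`: the triple `(x, y, r)` stands for the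
occurrence `r x y` of `321`, and `(x, y, c)` with `c < r` for the occurrence `c r x y` of `3412`. -/
noncomputable def topTriples (π : ℕ → ℕ) (r : ℕ) : Finset (ℕ × ℕ × ℕ) :=
  (range r ×ˢ range r ×ˢ range (r + 1)).filter fun o =>
    π r < π o.1 ∧ π o.1 < π o.2.1 ∧
      ((o.2.1 < o.1 ∧ o.2.2 = r) ∨
        (o.1 < o.2.1 ∧ o.2.1 < o.2.2 ∧ o.2.2 < r ∧ π o.2.2 < π r))

theorem mem_topTriples {π : ℕ → ℕ} {r x y c : ℕ} :
    (x, y, c) ∈ topTriples π r ↔ x < r ∧ y < r ∧ π r < π x ∧ π x < π y ∧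
      ((y < x ∧ c = r) ∨ (x < y ∧ y < c ∧ c < r ∧ π c < π r)) := by
  simp only [topTriples, mem_filter, mem_product, mem_range]
  constructor
  · rintro ⟨⟨h1, h2, h3⟩, h4, h5, h6⟩
    exact ⟨h1, h2, h4, h5, h6⟩
  · rintro ⟨h1, h2, h4, h5, h6⟩
    exact ⟨⟨h1, h2, by omega⟩, h4, h5, h6⟩

/-- The occurrence `o` may be charged to the value `x`. -/
def Charges (π : ℕ → ℕ) (r x : ℕ) (o : ℕ × ℕ × ℕ) : Prop :=
  (o.1 = x ∧ o.2.2 = r ∧ o.2.1 < x ∧ ∀ t < x, π t ≤ π o.2.1) ∨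
  (o.1 = x ∧ o.2.2 < r ∧ ∀ t < x, π t ≤ π x) ∨
  (o.2.1 = x ∧ o.2.2 = r ∧ (∀ t < x, π t ≤ π x) ∧
    (∀ y c, x < y → π x < π y → y < c → c < r → ¬ π c < π r) ∧
    ∃ y, x < y ∧ y < o.1 ∧ π x < π y)

theorem Charges.eq {π : ℕ → ℕ} {r x x' : ℕ} {o : ℕ × ℕ × ℕ}
    (h : Charges π r x o) (h' : Charges π r x' o) : x = x' := by
  obtain ⟨u, v, c⟩ := o
  simp only [Charges] at h h'
  rcases h with ⟨h1, h2, h3, h4⟩ | ⟨h1, h2, h3⟩ | ⟨h1, h2, h3, h4, y, h5, h6, h7⟩ <;>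
  rcases h' with ⟨g1, g2, g3, g4⟩ | ⟨g1, g2, g3⟩ | ⟨g1, g2, g3, g4, z, g5, g6, g7⟩ <;>
  first
  | omega
  | (have := h4 z (by omega); subst g1; omega)
  | (have := g4 y (by omega); subst h1; omega)

/-- A value to which no `r`-occurrence can be charged separates the values below `r`. -/
theorem lt_of_forall_not_charges {π : ℕ → ℕ} (hπ : Function.Injective π) {r x : ℕ}
    (hx : x ∈ smallerAfter π r) (h : ∀ o ∈ topTriples π r, ¬ Charges π r x o)
    {s t : ℕ} (hs : s < r) (hsx : π s ≤ π x) (hxt : π x < π t) : s < t := by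
  simp only [smallerAfter, mem_filter, mem_range] at hx
  obtain ⟨hxr, hrx⟩ := hx
  have hmin : ∀ t < x, π t ≤ π x := by
    by_contra! hcon
    obtain ⟨t₀, ht₀, ht₀'⟩ := hcon
    obtain ⟨y, hy, hmax⟩ := ((range x).filter fun t => π x < π t).exists_max_image π
      ⟨t₀, by simp [ht₀, ht₀']⟩
    simp only [mem_filter, mem_range] at hy hmax
    refine h (x, y, r) (mem_topTriples.2 ⟨hxr, by omega, hrx, hy.2, Or.inl ⟨hy.1, rfl⟩⟩)
      (Or.inl ⟨rfl, rfl, hy.1, fun t ht => ?_⟩)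
    by_cases hc : π x < π t
    · exact hmax t ⟨ht, hc⟩
    · exact le_trans (not_lt.1 hc) hy.2.le
  have hcross : ∀ y c, x < y → π x < π y → y < c → c < r → ¬ π c < π r := by
    intro y c h1 h2 h3 h4 h5
    exact h (x, y, c)
      (mem_topTriples.2 ⟨hxr, by omega, hrx, h2, Or.inr ⟨h1, h3, h4, h5⟩⟩)
      (Or.inr (Or.inl ⟨rfl, h4, hmin⟩))
  have hxt' : x < t := by
    by_contra! hcon
    rcases hcon.lt_or_eq with hlt | rfl
    · have := hmin t hlt
      omega
    · omega
  by_contra! hcon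
  have hne : t ≠ s := by rintro rfl; omega
  have hts : t < s := by omega
  have hsr : π r < π s := by
    rcases lt_trichotomy (π s) (π r) with h1 | h1 | h1
    · exact absurd h1 (hcross t s hxt' hxt hts hs)
    · have := hπ h1
      omega
    · exact h1
  have hsx' : π s < π x := by
    rcases hsx.lt_or_eq with h1 | h1
    · exact h1
    · have := hπ h1
      omega
  exact h (s, x, r) (mem_topTriples.2 ⟨hs, hxr, hsr, hsx', Or.inl ⟨by omega, rfl⟩⟩)
    (Or.inr (Or.inr ⟨rfl, rfl, hmin, hcross, t, hxt', hts, hxt⟩))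

theorem card_uncharged_le {π : ℕ → ℕ} (hπ : Function.Injective π) (r : ℕ) :
    #((smallerAfter π r).filter fun x => ¬ ∃ o ∈ topTriples π r, Charges π r x o) ≤
      #(brokenCuts π (r + 1) \ brokenCuts π r) := by
  have hmax : ∀ x, x ∈ smallerAfter π r →
      ∃ M, M < r ∧ π M ≤ π x ∧ ∀ t < r, π t ≤ π x → t ≤ M := by
    intro x hx
    simp only [smallerAfter, mem_filter, mem_range] at hx
    obtain ⟨M, hM, hM'⟩ := ((range r).filter fun t => π t ≤ π x).exists_max_image id
      ⟨x, by simp [hx.1]⟩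
    simp only [mem_filter, mem_range, id] at hM hM'
    exact ⟨M, hM.1, hM.2, fun t h1 h2 => hM' t ⟨h1, h2⟩⟩
  choose! M hMr hMx hM using hmax
  apply card_le_card_of_injOn M
  · intro x hx
    simp only [coe_filter, Set.mem_ofPred_eq, not_exists, not_and] at hx
    obtain ⟨hxA, hx⟩ := hx
    have hxA' := hxA
    simp only [smallerAfter, mem_filter, mem_range] at hxA'
    simp only [coe_sdiff, brokenCuts, Set.mem_sdiff, mem_coe, mem_filter, mem_range, not_and,
      not_exists]
    refine ⟨⟨(hMr x hxA).trans r.lt_succ_self, x, r, hM x hxA x hxA'.1 le_rfl, hMr x hxA,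
      r.lt_succ_self, hxA'.2⟩, fun _ a b ha hb hbr hab => ?_⟩
    have hxb : π x < π b := by
      by_contra! hc
      have := hM x hxA b hbr hc
      omega
    have := lt_of_forall_not_charges hπ hxA hx (hMr x hxA) (hMx x hxA)
      (hxb.trans hab)
    omega
  · intro x hx x' hx' heq
    simp only [coe_filter, Set.mem_ofPred_eq, not_exists, not_and] at hx hx'
    have key : ∀ {x x'}, x ∈ smallerAfter π r → (∀ o ∈ topTriples π r, ¬ Charges π r x o) →
        x' ∈ smallerAfter π r → π x < π x' → M x < M x' := by
      intro x x' hx h hx' hlt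
      have hr' : x' < r := by
        simp only [smallerAfter, mem_filter, mem_range] at hx'
        exact hx'.1
      exact (lt_of_forall_not_charges hπ hx h (hMr x hx) (hMx x hx) hlt).trans_le
        (hM x' hx' x' hr' le_rfl)
    rcases lt_trichotomy (π x) (π x') with h | h | h
    · exact absurd heq (key hx.1 hx.2 hx'.1 h).ne
    · exact hπ h
    · exact absurd heq (key hx'.1 hx'.2 hx.1 h).ne'

/-- The position function `π` has an `r`-occurrence of one of the ten patterns of `Φ`. -/
def HasTopOcc (π : ℕ → ℕ) (r : ℕ) : Prop :=
  (∃ z y x, x < y ∧ y < z ∧ z < r ∧ π r < π z ∧ π z < π y ∧ π y < π x) ∨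
  (∃ c d x y, x < y ∧ y < c ∧ y < d ∧ c < r ∧ d < r ∧ c ≠ d ∧
    π c < π r ∧ π d < π r ∧ π r < π x ∧ π x < π y) ∨
  (∃ c x y z, x < y ∧ x < z ∧ y < c ∧ z < c ∧ c < r ∧ y ≠ z ∧
    π c < π r ∧ π r < π x ∧ π x < π y ∧ π x < π z) ∨
  (∃ c z x y, x < y ∧ y < c ∧ y < z ∧ c < r ∧ z < r ∧
    π c < π r ∧ π r < π z ∧ π z < π x ∧ π x < π y) ∨
  (∃ c x y z, z < x ∧ x < y ∧ y < c ∧ c < r ∧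
    π c < π r ∧ π r < π x ∧ π x < π y ∧ π x < π z) ∨
  (∃ c d x y, x < y ∧ y < c ∧ y < d ∧ c < r ∧ d < r ∧ c ≠ d ∧
    π r < π c ∧ π r < π d ∧ π c < π x ∧ π d < π x ∧ π x < π y)

/-- Two distinct occurrences chargeable only to `x` cannot both be used. -/
theorem exists_unused_of_pair {π : ℕ → ℕ} {r x : ℕ} {f : ℕ → ℕ × ℕ × ℕ} {s : Finset ℕ}
    (hf : ∀ x ∈ s, Charges π r x (f x)) {o o' : ℕ × ℕ × ℕ}
    (ho : o ∈ topTriples π r) (ho' : o' ∈ topTriples π r) (hne : o ≠ o')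
    (h : ∀ x', Charges π r x' o → x' = x) (h' : ∀ x', Charges π r x' o' → x' = x) :
    ∃ o ∈ topTriples π r, ∀ x ∈ s, f x ≠ o := by
  by_cases hx : f x = o
  · refine ⟨o', ho', fun x' hx' he => hne ?_⟩
    rw [← hx, ← he, h' x' (he ▸ hf x' hx')]
  · refine ⟨o, ho, fun x' hx' he => hx ?_⟩
    rwa [← h x' (he ▸ hf x' hx')]

theorem HasTopOcc.exists_unused {π : ℕ → ℕ} {r : ℕ} (h : HasTopOcc π r)
    {f : ℕ → ℕ × ℕ × ℕ} {s : Finset ℕ} (hf : ∀ x ∈ s, Charges π r x (f x)) :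
    ∃ o ∈ topTriples π r, ∀ x ∈ s, f x ≠ o := by
  have hnone : ∀ o ∈ topTriples π r, (∀ x, ¬ Charges π r x o) →
      ∃ o ∈ topTriples π r, ∀ x ∈ s, f x ≠ o :=
    fun o ho h => ⟨o, ho, fun x hx he => h x (he ▸ hf x hx)⟩
  rcases h with ⟨z, y, x, h1, h2, h3, h4, h5, h6⟩ |
    ⟨c, d, x, y, h1, h2, h3, h4, h5, h6, h7, h8, h9, h10⟩ |
    ⟨c, x, y, z, h1, h2, h3, h4, h5, h6, h7, h8, h9, h10⟩ |
    ⟨c, z, x, y, h1, h2, h3, h4, h5, h6, h7, h8, h9⟩ |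
    ⟨c, x, y, z, h1, h2, h3, h4, h5, h6, h7, h8⟩ |
    ⟨c, d, x, y, h1, h2, h3, h4, h5, h6, h7, h8, h9, h10, h11⟩
  · refine hnone (z, y, r) (mem_topTriples.2 ⟨h3, by omega, h4, h5, Or.inl ⟨h2, rfl⟩⟩) ?_
    rintro x' (⟨e, -, -, g⟩ | ⟨-, g, -⟩ | ⟨e, -, g, -⟩) <;> dsimp only at *
    · exact absurd (g x (by omega)) (by omega)
    · omega
    · subst e
      exact absurd (g x h1) (by omega)
  · refine exists_unused_of_pair (x := x) (o := (x, y, c)) (o' := (x, y, d)) hf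
      (mem_topTriples.2 ⟨by omega, by omega, h9, h10, Or.inr ⟨h1, h2, h4, h7⟩⟩)
      (mem_topTriples.2 ⟨by omega, by omega, h9, h10, Or.inr ⟨h1, h3, h5, h8⟩⟩)
      (by simpa using h6) ?_ ?_ <;>
    · simp only [Charges]
      omega
  · refine exists_unused_of_pair (x := x) (o := (x, y, c)) (o' := (x, z, c)) hf
      (mem_topTriples.2 ⟨by omega, by omega, h8, h9, Or.inr ⟨h1, h3, h5, h7⟩⟩)
      (mem_topTriples.2 ⟨by omega, by omega, h8, h10, Or.inr ⟨h2, h4, h5, h7⟩⟩)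
      (by simpa using h6) ?_ ?_ <;>
    · simp only [Charges]
      omega
  · refine hnone (z, x, r)
      (mem_topTriples.2 ⟨h5, by omega, h7, h8, Or.inl ⟨by omega, rfl⟩⟩) ?_
    rintro x' (⟨e, -, -, g⟩ | ⟨-, g, -⟩ | ⟨e, -, -, g, -⟩) <;> dsimp only at *
    · exact absurd (g y (by omega)) (by omega)
    · omega
    · subst e
      exact g y c h1 h9 h2 h4 h6
  · refine hnone (x, y, c)
      (mem_topTriples.2 ⟨by omega, by omega, h6, h7, Or.inr ⟨h2, h3, h4, h5⟩⟩) ?_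
    rintro x' (⟨-, g, -⟩ | ⟨e, -, g⟩ | ⟨-, g, -⟩) <;> dsimp only at *
    · omega
    · subst e
      exact absurd (g z h1) (by omega)
    · omega
  · have hlast : ∀ c x', y < c → Charges π r x' (c, x, r) → x' = x := by
      rintro c x' hc (⟨e, -, -, g⟩ | ⟨-, g, -⟩ | ⟨e, -, -⟩) <;> dsimp only at *
      · exact absurd (g y (by omega)) (by omega)
      · omega
      · exact e.symm
    exact exists_unused_of_pair (x := x) (o := (c, x, r)) (o' := (d, x, r)) hf
      (mem_topTriples.2 ⟨h4, by omega, h7, h9, Or.inl ⟨by omega, rfl⟩⟩)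
      (mem_topTriples.2 ⟨h5, by omega, h8, h10, Or.inl ⟨by omega, rfl⟩⟩)
      (by simpa using h6) (fun x' => hlast c x' h2) (fun x' => hlast d x' h3)

theorem card_charged_add_le (π : ℕ → ℕ) (r : ℕ) :
    #((smallerAfter π r).filter fun x => ∃ o ∈ topTriples π r, Charges π r x o) +
      (if HasTopOcc π r then 1 else 0) ≤ #(topTriples π r) := by
  set s := (smallerAfter π r).filter fun x => ∃ o ∈ topTriples π r, Charges π r x o
  have hex : ∀ x, x ∈ s → ∃ o, o ∈ topTriples π r ∧ Charges π r x o :=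
    fun x hx => (mem_filter.1 hx).2
  choose! f hfO hf using hex
  have hcard : #(s.image f) = #s :=
    card_image_of_injOn fun x hx x' hx' he => (hf x hx).eq (he ▸ hf x' hx')
  have hsub : s.image f ⊆ topTriples π r := image_subset_iff.2 hfO
  split_ifs with hΦ
  · obtain ⟨o, ho, hne⟩ := hΦ.exists_unused hf
    rw [← hcard]
    refine card_lt_card (hsub.ssubset_of_ne fun he => ?_)
    rw [← he, mem_image] at ho
    obtain ⟨x, hx, hxo⟩ := ho
    exact hne x hx hxo
  · rw [← hcard]
    exact card_le_card hsub

theorem card_smallerAfter_add_le {π : ℕ → ℕ} (hπ : Function.Injective π) (r : ℕ) :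
    #(smallerAfter π r) + (if HasTopOcc π r then 1 else 0) ≤
      #(brokenCuts π (r + 1) \ brokenCuts π r) + #(topTriples π r) := by
  have h1 := card_uncharged_le hπ r
  have h2 := card_charged_add_le π r
  have h3 := card_filter_add_card_filter_not (s := smallerAfter π r)
    (fun x => ∃ o ∈ topTriples π r, Charges π r x o)
  omega

theorem sum_card_smallerAfter_add_le {π : ℕ → ℕ} (hπ : Function.Injective π) (m : ℕ) :
    ∑ r ∈ range m, #(smallerAfter π r) + #((range m).filter (HasTopOcc π)) ≤
      #(brokenCuts π m) + ∑ r ∈ range m, #(topTriples π r) := by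
  induction m with
  | zero => simp
  | succ m ih =>
    have hstep := card_smallerAfter_add_le hπ m
    have hsub : brokenCuts π m ⊆ brokenCuts π (m + 1) := by
      intro k hk
      simp only [brokenCuts, mem_filter, mem_range] at hk ⊢
      obtain ⟨hk, a, b, h1, h2, h3, h4⟩ := hk
      exact ⟨by omega, a, b, h1, h2, by omega, h4⟩
    have hD := card_sdiff_add_card_eq_card hsub
    have hf : #((range (m + 1)).filter (HasTopOcc π)) =
        #((range m).filter (HasTopOcc π)) + (if HasTopOcc π m then 1 else 0) := by
      simp only [card_filter, sum_range_succ]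
    rw [sum_range_succ, sum_range_succ]
    omega

end PositionFunction

section PermutationPositions

open Finset

/-- The position of the value `v` in `w`, extended by the identity to all of `ℕ`. -/
def position {m : ℕ} (w : Equiv.Perm (Fin m)) (v : ℕ) : ℕ :=
  if h : v < m then (w⁻¹ ⟨v, h⟩ : ℕ) else v

variable {m : ℕ} (w : Equiv.Perm (Fin m))

theorem position_coe (v : Fin m) : position w v = w⁻¹ v := by
  simp [position]

theorem position_apply (i : Fin m) : position w (w i) = i := by
  simp [position_coe]

theorem position_injective : Function.Injective (position w) := by
  intro a b h
  unfold position at h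
  split_ifs at h with ha hb hb
  · simpa using Fin.ext h
  · have := (w⁻¹ ⟨a, ha⟩).isLt
    omega
  · have := (w⁻¹ ⟨b, hb⟩).isLt
    omega
  · exact h

/-- The pairs of values of `w` that are out of order. -/
def inversions : Finset (Fin m × Fin m) :=
  univ.filter fun p => p.1 < p.2 ∧ w⁻¹ p.2 < w⁻¹ p.1

theorem eq_one_of_forall_adjacent
    (h : ∀ i (hi : i + 1 < m), w⁻¹ ⟨i, by omega⟩ < w⁻¹ ⟨i + 1, hi⟩) : w = 1 := by
  have hmono : StrictMono (w⁻¹ : Equiv.Perm (Fin m)) := by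
    cases m with
    | zero => exact fun a => a.elim0
    | succ n => exact Fin.strictMono_iff_lt_succ.2 fun i => h i (by omega)
  have hid : (w⁻¹ : Equiv.Perm (Fin m)) = 1 := by
    ext i
    have : hmono.orderIsoOfSurjective _ (w⁻¹).surjective = OrderIso.refl _ :=
      Subsingleton.elim _ _
    have := DFunLike.congr_fun this i
    simpa using congrArg Fin.val this
  simpa using hid

theorem card_inversions_swap_lt {i : ℕ} (hi : i + 1 < m)
    (h : w⁻¹ ⟨i + 1, hi⟩ < w⁻¹ ⟨i, by omega⟩) :
    #(inversions (sr m i * w)) < #(inversions w) := by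
  set p : Fin m := ⟨i, by omega⟩ with hp
  set q : Fin m := ⟨i + 1, hi⟩ with hq
  have hs : sr m i = Equiv.swap p q := by simp [sr, hi, hp, hq]
  have hinv : ∀ v, (sr m i * w)⁻¹ v = w⁻¹ (Equiv.swap p q v) := by
    intro v
    simp [hs, mul_inv_rev]
  have hpq : p < q := by simp [hp, hq]
  have hmem : (p, q) ∈ inversions w := mem_filter.2 ⟨mem_univ _, hpq, h⟩
  rw [← card_erase_add_one hmem, Nat.lt_succ_iff]
  refine card_le_card_of_injOn (fun x => (Equiv.swap p q x.1, Equiv.swap p q x.2)) ?_ ?_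
  · rintro ⟨a, b⟩ hab
    simp only [inversions, coe_filter, mem_univ, true_and, Set.mem_ofPred_eq, hinv] at hab
    obtain ⟨h1, h2⟩ := hab
    simp only [inversions, coe_erase, coe_filter, mem_univ, true_and, Set.mem_sdiff,
      Set.mem_ofPred_eq, Set.mem_singleton_iff, Prod.mk.injEq, not_and]
    have hne : ¬ (a = p ∧ b = q) := by
      rintro ⟨rfl, rfl⟩
      rw [Equiv.swap_apply_left, Equiv.swap_apply_right] at h2
      exact h.not_gt h2
    refine ⟨⟨?_, h2⟩, fun e1 e2 => ?_⟩
    · rw [Equiv.swap_apply_def, Equiv.swap_apply_def]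
      simp only [hp, hq, Fin.ext_iff, Fin.lt_def] at *
      split_ifs <;> simp <;> omega
    · have e1' : a = q := by
        rw [← Equiv.swap_apply_left p q] at e1
        simpa [e1] using congrArg (Equiv.swap p q) e1
      have e2' : b = p := by
        simpa using congrArg (Equiv.swap p q) e2
      subst e1' e2'
      exact h1.not_gt hpq
  · rintro ⟨a, b⟩ - ⟨c, d⟩ - he
    simpa using he

theorem exists_isWord_length_le : ∃ l, IsWord m l w ∧ l.length ≤ #(inversions w) := by
  induction hN : #(inversions w) using Nat.strong_induction_on generalizing w with
  | _ N ih =>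
    by_cases hdesc : ∀ i (hi : i + 1 < m), w⁻¹ ⟨i, by omega⟩ < w⁻¹ ⟨i + 1, hi⟩
    · exact ⟨[], ⟨by simp, by simp [eq_one_of_forall_adjacent w hdesc]⟩, by simp⟩
    · push Not at hdesc
      obtain ⟨i, hi, hle⟩ := hdesc
      have hlt : w⁻¹ ⟨i + 1, hi⟩ < w⁻¹ ⟨i, by omega⟩ := by
        refine lt_of_le_of_ne hle fun he => ?_
        have := congrArg Fin.val ((w⁻¹).injective he)
        simp at this
      have hcard := card_inversions_swap_lt w hi hlt
      obtain ⟨l, ⟨hl, hprod⟩, hlen⟩ := ih _ (hN ▸ hcard) _ rfl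
      refine ⟨i :: l, ⟨?_, ?_⟩, ?_⟩
      · simpa [hi] using hl
      · rw [List.map_cons, List.prod_cons, hprod, ← mul_assoc]
        simp [sr, hi]
      · simp only [List.length_cons]
        omega

theorem len_le_card_inversions : len w ≤ #(inversions w) := by
  obtain ⟨l, hl, hlen⟩ := exists_isWord_length_le w
  have : len w ≤ l.length := Nat.sInf_le ⟨l, hl, rfl⟩
  exact this.trans hlen

theorem exists_isReducedWord : ∃ l, IsReducedWord w l := by
  obtain ⟨l, hl, -⟩ := exists_isWord_length_le w
  exact Nat.sInf_mem (s := {c | ∃ l : List ℕ, IsWord m l w ∧ l.length = c})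
    ⟨l.length, l, hl, rfl⟩

theorem sr_le_iff {i k : ℕ} (hik : i ≠ k) (v : Fin m) : (sr m i v : ℕ) ≤ k ↔ (v : ℕ) ≤ k := by
  unfold sr
  split_ifs with h
  · rw [Equiv.swap_apply_def]
    split_ifs with h1 h2
    · subst h1
      simp only
      omega
    · subst h2
      simp only
      omega
    · rfl
  · rfl

theorem list_prod_le_iff {l : List ℕ} {k : ℕ} (hk : k ∉ l) (v : Fin m) :
    ((l.map (sr m)).prod v : ℕ) ≤ k ↔ (v : ℕ) ≤ k := by
  induction l with
  | nil => simp
  | cons i l ih =>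
    simp only [List.mem_cons, not_or] at hk
    rw [List.map_cons, List.prod_cons, Equiv.Perm.mul_apply, sr_le_iff (Ne.symm hk.1), ih hk.2]

theorem brokenCuts_subset_toFinset {l : List ℕ} (hl : IsWord m l w) :
    brokenCuts (position w) m ⊆ l.toFinset := by
  intro k hk
  simp only [brokenCuts, mem_filter, mem_range] at hk
  obtain ⟨hkm, a, b, hak, hkb, hbm, hba⟩ := hk
  rw [List.mem_toFinset]
  by_contra hkl
  have key : ∀ v (hv : v < m), v ≤ k ↔ position w v ≤ k := by
    intro v hv
    have := list_prod_le_iff hkl (w⁻¹ ⟨v, hv⟩)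
    rw [hl.2, show w (w⁻¹ ⟨v, hv⟩) = ⟨v, hv⟩ from w.apply_symm_apply _] at this
    simpa [position, hv] using this
  have ha := key a (by omega)
  have hb := key b hbm
  omega

theorem supp_finite : (supp w).Finite :=
  (Set.finite_lt_nat m).subset fun i ⟨_, hl, hi⟩ => by
    have := hl.1.1 i hi
    simp only [Set.mem_ofPred_eq]
    omega

theorem rep_le_sub :
    rep w ≤ #(inversions w) - #(brokenCuts (position w) m) ∧
      #(brokenCuts (position w) m) ≤ #(inversions w) := by
  obtain ⟨l, hl⟩ := exists_isReducedWord w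
  have hsub := brokenCuts_subset_toFinset w hl.1
  have h1 : #(brokenCuts (position w) m) ≤ (supp w).ncard := by
    rw [← Set.ncard_coe_finset]
    refine Set.ncard_le_ncard (fun k hk => ⟨l, hl, ?_⟩) (supp_finite w)
    exact List.mem_toFinset.1 (hsub hk)
  have h2 := (card_le_card hsub).trans l.toFinset_card_le
  have h3 := len_le_card_inversions w
  rw [hl.2] at h2
  unfold rep
  omega

theorem card_inversions_eq_sum :
    #(inversions w) = ∑ r ∈ range m, #(smallerAfter (position w) r) := by
  rw [← card_sigma]
  refine card_bij (fun p _ => ⟨p.2, p.1⟩) ?_ ?_ ?_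
  · rintro ⟨a, b⟩ h
    simp only [inversions, mem_filter, mem_univ, true_and] at h
    simp only [smallerAfter, mem_sigma, mem_range, mem_filter, position_coe]
    exact ⟨b.isLt, h.1, h.2⟩
  · rintro ⟨a, b⟩ - ⟨c, d⟩ - h
    simp only [Sigma.mk.injEq, heq_eq_eq] at h
    exact Prod.ext (Fin.ext h.2) (Fin.ext h.1)
  · rintro ⟨b, a⟩ h
    simp only [smallerAfter, mem_sigma, mem_range, mem_filter] at h
    obtain ⟨hb, hab, h⟩ := h
    refine ⟨(⟨a, by omega⟩, ⟨b, hb⟩), ?_, rfl⟩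
    simp only [inversions, mem_filter, mem_univ, true_and]
    refine ⟨hab, ?_⟩
    rw [Fin.lt_def, ← position_coe, ← position_coe]
    exact h

end PermutationPositions

section Occurrences

open Finset

variable {m : ℕ} {w : Equiv.Perm (Fin m)}

theorem isOccSet_p321 {r x y : ℕ} (hr : r < m) (hxr : x < r) (hyx : y < x)
    (h1 : position w r < position w x) (h2 : position w x < position w y) :
    IsOccSet p321 w {r, x, y} := by
  have hx : x < m := by omega
  have hy : y < m := by omega
  simp only [position, hr, hx, hy, dif_pos] at h1 h2
  refine ⟨![w⁻¹ ⟨r, hr⟩, w⁻¹ ⟨x, hx⟩, w⁻¹ ⟨y, hy⟩], ?_, ?_, ?_⟩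
  · rw [Fin.strictMono_iff_lt_succ]
    intro i
    fin_cases i
    exacts [h1, h2]
  · intro a b
    fin_cases a <;> fin_cases b <;> simp [p321] <;> omega
  · ext v
    simp [Fin.exists_fin_succ]
    grind

theorem isOccSet_p3412 {r x y c : ℕ} (hr : r < m) (hxy : x < y) (hyc : y < c) (hcr : c < r)
    (h0 : position w c < position w r)
    (h1 : position w r < position w x) (h2 : position w x < position w y) :
    IsOccSet p3412 w {r, x, y, c} := by
  have hx : x < m := by omega
  have hy : y < m := by omega
  have hc : c < m := by omega
  simp only [position, hr, hx, hy, hc, dif_pos] at h0 h1 h2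
  refine ⟨![w⁻¹ ⟨c, hc⟩, w⁻¹ ⟨r, hr⟩, w⁻¹ ⟨x, hx⟩, w⁻¹ ⟨y, hy⟩], ?_, ?_, ?_⟩
  · rw [Fin.strictMono_iff_lt_succ]
    intro i
    fin_cases i
    exacts [h0, h1, h2]
  · intro a b
    fin_cases a <;> fin_cases b <;> simp [p3412] <;> omega
  · ext v
    simp [Fin.exists_fin_succ]
    grind

theorem isOccSet_finite {c : ℕ} (p : Fin c → ℕ) (w : Equiv.Perm (Fin m)) :
    {S | IsOccSet p w S}.Finite := by
  refine (range m).powerset.finite_toSet.subset ?_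
  rintro S ⟨f, -, -, rfl⟩
  simp only [coe_powerset, Set.mem_preimage, Set.mem_powerset_iff, coe_subset, subset_iff,
    mem_image, mem_univ, true_and, mem_range]
  rintro _ ⟨a, rfl⟩
  exact (w (f a)).isLt

theorem sum_card_topTriples_le (w : Equiv.Perm (Fin m)) :
    ∑ r ∈ range m, #(topTriples (position w) r) ≤ occCount p321 w + occCount p3412 w := by
  rw [← card_sigma]
  refine le_trans ?_ (Set.ncard_union_le _ _)
  rw [← Set.ncard_coe_finset]
  refine Set.ncard_le_ncard_of_injOn
    (fun o : (_ : ℕ) × (ℕ × ℕ × ℕ) => ({o.1, o.2.1, o.2.2.1, o.2.2.2} : Finset ℕ)) ?_ ?_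
    ((isOccSet_finite _ w).union (isOccSet_finite _ w))
  · rintro ⟨r, x, y, c⟩ h
    simp only [mem_coe, mem_sigma, mem_range, mem_topTriples] at h
    obtain ⟨hr, hx, hy, h1, h2, ⟨h3, rfl⟩ | ⟨h3, h4, h5, h6⟩⟩ := h
    · left
      have : ({c, x, y, c} : Finset ℕ) = {c, x, y} := by
        ext v
        simp
        tauto
      simp only [this]
      exact isOccSet_p321 hr hx h3 h1 h2
    · right
      exact isOccSet_p3412 hr h3 h4 h5 h6 h1 h2
  · rintro ⟨r, x, y, c⟩ h ⟨r', x', y', c'⟩ h' he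
    simp only [mem_coe, mem_sigma, mem_range, mem_topTriples] at h h'
    obtain ⟨-, hx, hy, -, -, h⟩ := h
    obtain ⟨-, hx', hy', -, -, h'⟩ := h'
    simp only [Finset.ext_iff, mem_insert, mem_singleton] at he
    have hr := he r
    have hr' := he r'
    obtain rfl : r = r' := by omega
    have e1 := (he x).1 (by simp)
    have e2 := (he y).1 (by simp)
    have e3 := (he c).1 (by simp)
    have e4 := (he x').2 (by simp)
    have e5 := (he y').2 (by simp)
    have e6 := (he c').2 (by simp)
    clear hr hr' he
    have : x = x' ∧ y = y' ∧ c = c' := by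
      rcases h with ⟨h1, h2⟩ | ⟨h1, h2, h3, -⟩ <;>
      rcases h' with ⟨g1, g2⟩ | ⟨g1, g2, g3, -⟩ <;> omega
    obtain ⟨rfl, rfl, rfl⟩ := this
    rfl

/-- The values of an occurrence of a pattern, together with their positions. -/
theorem IsOccSet.exists_values {c : ℕ} {p : Fin c → ℕ} {S : Finset ℕ} (h : IsOccSet p w S) :
    ∃ v : Fin c → ℕ, (∀ a b, a < b → position w (v a) < position w (v b)) ∧
      (∀ a b, p a < p b → v a < v b) ∧ (∀ a, v a < m) ∧ ∀ x, x ∈ S ↔ ∃ a, v a = x := by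
  obtain ⟨f, hf, hp, rfl⟩ := h
  refine ⟨fun a => w (f a), fun a b hab => ?_, fun a b hab => (hp a b).1 hab,
    fun a => (w (f a)).isLt, fun x => by simp⟩
  simp only [position_apply]
  exact hf hab

/-- If `p` attains its maximum at `t`, then an `r`-occurrence of `p` has the value `r` at `t`. -/
theorem IsOccSet.exists_top_values {c : ℕ} {p : Fin c → ℕ} {S : Finset ℕ} {r : ℕ}
    (h : IsOccSet p w S) (hr : r ∈ S) (hmax : ∀ v ∈ S, v ≤ r) (t : Fin c)
    (ht : ∀ a, a ≠ t → p a < p t) :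
    ∃ v : Fin c → ℕ, (∀ a b, a < b → position w (v a) < position w (v b)) ∧
      (∀ a b, p a < p b → v a < v b) ∧ v t = r ∧ r < m := by
  obtain ⟨v, h1, h2, h3, h4⟩ := h.exists_values
  obtain ⟨a, rfl⟩ := (h4 r).1 hr
  refine ⟨v, h1, h2, ?_, h3 a⟩
  by_cases hat : a = t
  · rw [hat]
  · have := h2 a t (ht a hat)
    have := hmax (v t) ((h4 _).2 ⟨t, rfl⟩)
    omega

theorem hasTopOcc_of_isOccSet {r : ℕ} {S : Finset ℕ}
    (h : IsOccSet p4321 w S ∨ IsOccSet p34512 w S ∨ IsOccSet p45123 w S ∨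
      IsOccSet p35412 w S ∨ IsOccSet p43512 w S ∨ IsOccSet p45132 w S ∨
      IsOccSet p45213 w S ∨ IsOccSet p53412 w S ∨ IsOccSet p45312 w S ∨
      IsOccSet p45231 w S) (hr : r ∈ S) (hmax : ∀ v ∈ S, v ≤ r) :
    r < m ∧ HasTopOcc (position w) r := by
  rcases h with h | h | h | h | h | h | h | h | h | h
  · obtain ⟨v, hπ, hv, rfl, hm⟩ := h.exists_top_values hr hmax 0 (by decide)
    exact ⟨hm, Or.inl ⟨v 1, v 2, v 3, hv _ _ (by decide), hv _ _ (by decide),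
      hv _ _ (by decide), hπ _ _ (by decide), hπ _ _ (by decide), hπ _ _ (by decide)⟩⟩
  · obtain ⟨v, hπ, hv, rfl, hm⟩ := h.exists_top_values hr hmax 2 (by decide)
    exact ⟨hm, Or.inr (Or.inl ⟨v 0, v 1, v 3, v 4, hv _ _ (by decide), hv _ _ (by decide),
      hv _ _ (by decide), hv _ _ (by decide), hv _ _ (by decide), (hv _ _ (by decide)).ne,
      hπ _ _ (by decide), hπ _ _ (by decide), hπ _ _ (by decide), hπ _ _ (by decide)⟩)⟩
  · obtain ⟨v, hπ, hv, rfl, hm⟩ := h.exists_top_values hr hmax 1 (by decide)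
    exact ⟨hm, Or.inr (Or.inr (Or.inl ⟨v 0, v 2, v 3, v 4, hv _ _ (by decide),
      hv _ _ (by decide), hv _ _ (by decide), hv _ _ (by decide), hv _ _ (by decide),
      (hv _ _ (by decide)).ne, hπ _ _ (by decide), hπ _ _ (by decide), hπ _ _ (by decide),
      hπ _ _ (by decide)⟩))⟩
  · obtain ⟨v, hπ, hv, rfl, hm⟩ := h.exists_top_values hr hmax 1 (by decide)
    exact ⟨hm, Or.inr (Or.inr (Or.inr (Or.inl ⟨v 0, v 2, v 3, v 4, hv _ _ (by decide),
      hv _ _ (by decide), hv _ _ (by decide), hv _ _ (by decide), hv _ _ (by decide),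
      hπ _ _ (by decide), hπ _ _ (by decide), hπ _ _ (by decide), hπ _ _ (by decide)⟩)))⟩
  · obtain ⟨v, hπ, hv, rfl, hm⟩ := h.exists_top_values hr hmax 2 (by decide)
    exact ⟨hm, Or.inr (Or.inl ⟨v 0, v 1, v 3, v 4, hv _ _ (by decide), hv _ _ (by decide),
      hv _ _ (by decide), hv _ _ (by decide), hv _ _ (by decide), (hv _ _ (by decide)).ne',
      hπ _ _ (by decide), hπ _ _ (by decide), hπ _ _ (by decide), hπ _ _ (by decide)⟩)⟩
  · obtain ⟨v, hπ, hv, rfl, hm⟩ := h.exists_top_values hr hmax 1 (by decide)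
    exact ⟨hm, Or.inr (Or.inr (Or.inl ⟨v 0, v 2, v 3, v 4, hv _ _ (by decide),
      hv _ _ (by decide), hv _ _ (by decide), hv _ _ (by decide), hv _ _ (by decide),
      (hv _ _ (by decide)).ne', hπ _ _ (by decide), hπ _ _ (by decide), hπ _ _ (by decide),
      hπ _ _ (by decide)⟩))⟩
  · obtain ⟨v, hπ, hv, rfl, hm⟩ := h.exists_top_values hr hmax 1 (by decide)
    exact ⟨hm, Or.inr (Or.inr (Or.inr (Or.inr (Or.inl ⟨v 0, v 2, v 4, v 3,
      hv _ _ (by decide), hv _ _ (by decide), hv _ _ (by decide), hv _ _ (by decide),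
      hπ _ _ (by decide), hπ _ _ (by decide), hπ _ _ (by decide), hπ _ _ (by decide)⟩))))⟩
  · obtain ⟨v, hπ, hv, rfl, hm⟩ := h.exists_top_values hr hmax 0 (by decide)
    exact ⟨hm, Or.inr (Or.inr (Or.inr (Or.inr (Or.inr ⟨v 1, v 2, v 3, v 4,
      hv _ _ (by decide), hv _ _ (by decide), hv _ _ (by decide), hv _ _ (by decide),
      hv _ _ (by decide), (hv _ _ (by decide)).ne, hπ _ _ (by decide), hπ _ _ (by decide),
      hπ _ _ (by decide), hπ _ _ (by decide), hπ _ _ (by decide)⟩))))⟩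
  · obtain ⟨v, hπ, hv, rfl, hm⟩ := h.exists_top_values hr hmax 1 (by decide)
    exact ⟨hm, Or.inr (Or.inr (Or.inr (Or.inl ⟨v 0, v 2, v 3, v 4, hv _ _ (by decide),
      hv _ _ (by decide), hv _ _ (by decide), hv _ _ (by decide), hv _ _ (by decide),
      hπ _ _ (by decide), hπ _ _ (by decide), hπ _ _ (by decide), hπ _ _ (by decide)⟩)))⟩
  · obtain ⟨v, hπ, hv, rfl, hm⟩ := h.exists_top_values hr hmax 1 (by decide)
    exact ⟨hm, Or.inr (Or.inr (Or.inr (Or.inr (Or.inl ⟨v 0, v 2, v 3, v 4,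
      hv _ _ (by decide), hv _ _ (by decide), hv _ _ (by decide), hv _ _ (by decide),
      hπ _ _ (by decide), hπ _ _ (by decide), hπ _ _ (by decide), hπ _ _ (by decide)⟩))))⟩

end Occurrences

/-- `[321;3412](w) - rep(w)` is at least the number of values `r` for
which `w` has an `r`-occurrence of some pattern in `Φ`. -/
theorem count_sub_rep_lower_bound {m : ℕ} (w : Equiv.Perm (Fin m)) :
    rep w + Set.ncard {r : ℕ | ∃ S : Finset ℕ,
        (IsOccSet p4321 w S ∨ IsOccSet p34512 w S ∨ IsOccSet p45123 w S ∨
         IsOccSet p35412 w S ∨ IsOccSet p43512 w S ∨ IsOccSet p45132 w S ∨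
         IsOccSet p45213 w S ∨ IsOccSet p53412 w S ∨ IsOccSet p45312 w S ∨
         IsOccSet p45231 w S) ∧ r ∈ S ∧ ∀ v ∈ S, v ≤ r} ≤
      occCount p321 w + occCount p3412 w := by
  classical
  have h1 := sum_card_smallerAfter_add_le (position_injective w) m
  have h2 := rep_le_sub w
  have h3 := sum_card_topTriples_le w
  rw [← card_inversions_eq_sum] at h1
  have h4 : Set.ncard {r : ℕ | ∃ S : Finset ℕ,
        (IsOccSet p4321 w S ∨ IsOccSet p34512 w S ∨ IsOccSet p45123 w S ∨
         IsOccSet p35412 w S ∨ IsOccSet p43512 w S ∨ IsOccSet p45132 w S ∨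
         IsOccSet p45213 w S ∨ IsOccSet p53412 w S ∨ IsOccSet p45312 w S ∨
         IsOccSet p45231 w S) ∧ r ∈ S ∧ ∀ v ∈ S, v ≤ r} ≤
      ((Finset.range m).filter (HasTopOcc (position w))).card := by
    rw [← Set.ncard_coe_finset]
    refine Set.ncard_le_ncard ?_ (Finset.finite_toSet _)
    rintro r ⟨S, hS, hr, hmax⟩
    simpa using hasTopOcc_of_isOccSet hS hr hmax
  omega
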